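/- arXiv:2009.09716 — 3 statements merged into one kernel-verified Lean document; each statement's English description precedes it below -/
import Mathlib

section
/- Let M ∈ ℂⁿˣⁿ be Hermitian positive semidefinite, and let e₀, e₁ ∈ ℂⁿ satisfy Re(e₁ᴴ M e₀) ≥ Re(e₀ᴴ M e₀). Then Re(e₁ᴴ M e₁) ≥ Re(e₀ᴴ M e₀). (Ascent property: any point that does not decrease the linearized objective does not decrease the quadratic objective.) -/
open Matrix
open scoped ComplexOrder

/-- The form `xᴴ M y` of a Hermitian matrix has symmetric real part. -/
theorem Matrix.IsHermitian.re_star_dotProduct_mulVec_comm {ι : Type*} [Fintype ι]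
    {M : Matrix ι ι ℂ} (hM : M.IsHermitian) (x y : ι → ℂ) :
    (star x ⬝ᵥ M *ᵥ y).re = (star y ⬝ᵥ M *ᵥ x).re := by
  have h : star (star x ⬝ᵥ M *ᵥ y) = star y ⬝ᵥ M *ᵥ x := by
    rw [star_dotProduct, star_star, star_mulVec, hM.eq, dotProduct_mulVec]
  rw [← h, Complex.star_def, Complex.conj_re]

/-- Ascent property of the majorization–minimization step: if `M` is Hermitian positive
semidefinite and `Re(e₁ᴴ M e₀) ≥ Re(e₀ᴴ M e₀)`, then `Re(e₁ᴴ M e₁) ≥ Re(e₀ᴴ M e₀)`. -/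
theorem mm_ascent_property (n : ℕ) (M : Matrix (Fin n) (Fin n) ℂ) (hM : M.PosSemidef)
    (e₀ e₁ : Fin n → ℂ) (h : (star e₀ ⬝ᵥ M *ᵥ e₀).re ≤ (star e₁ ⬝ᵥ M *ᵥ e₀).re) :
    (star e₀ ⬝ᵥ M *ᵥ e₀).re ≤ (star e₁ ⬝ᵥ M *ᵥ e₁).re := by
  have hnonneg := (Complex.le_def.1 (hM.dotProduct_mulVec_nonneg (e₁ - e₀))).1
  have hsymm := hM.isHermitian.re_star_dotProduct_mulVec_comm e₀ e₁
  simp only [star_sub, mulVec_sub, sub_dotProduct, dotProduct_sub, Complex.sub_re,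
    Complex.zero_re] at hnonneg
  linarith
end

section
/- Let Q, Q̄ ∈ ℂⁿˣⁿ be Hermitian positive semidefinite, σ² > 0, ω > 0, ε > 0. Define Ω(x) = Re(xᴴ Q x)/(Re(xᴴ Q̄ x) + σ²) and u(x) = h_ε(1 − Ω(x)/ω), where h_ε is the smooth hinge function. Then, viewing ℂⁿ as a real normed space, u is Fréchet differentiable at every x ∈ ℂⁿ with derivative the ℝ-linear map h ↦ −(2/ω)·max(0, min((1 − Ω(x)/ω)/ε, 1))·Re(gᴴ h), where v = Re(xᴴ Q̄ x) + σ² and g = (1/v) Q x − (Re(xᴴ Q x)/v²) Q̄ x. In particular the gradient of u vanishes wherever 1 − Ω(x)/ω < 0. -/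
open Matrix
open scoped ComplexOrder

/-- The smooth hinge surrogate function with smoothing parameter `ε`. -/
noncomputable def smoothHinge (ε : ℝ) (t : ℝ) : ℝ :=
  if t < 0 then 0 else if t ≤ ε then t ^ 2 / (2 * ε) else t - ε / 2

theorem hasDerivAt_max_zero_sq (t : ℝ) :
    HasDerivAt (fun s : ℝ => max 0 s ^ 2) (2 * max 0 t) t := by
  have hO : (fun s : ℝ => max 0 s ^ 2 - max 0 t ^ 2 - 2 * max 0 t * (s - t))
      =O[nhds t] fun s => ‖s - t‖ ^ 2 := by
    refine Asymptotics.IsBigO.of_bound 1 (Filter.Eventually.of_forall fun s => ?_)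
    rw [norm_pow, norm_norm, Real.norm_eq_abs, Real.norm_eq_abs, sq_abs, one_mul, abs_le]
    rcases le_total 0 s with hs | hs <;> rcases le_total 0 t with ht | ht <;>
      simp only [max_eq_left, max_eq_right, hs, ht] <;> constructor <;> nlinarith
  have h0 := (hO.hasFDerivAt (n := 2) (by norm_num)).hasDerivAt
  have h1 := (h0.add (((hasDerivAt_id t).sub_const t).const_mul (2 * max 0 t))).add_const
    (max 0 t ^ 2)
  refine (h1.congr_deriv (by simp)).congr_of_eventuallyEq
    (Filter.Eventually.of_forall fun s => ?_)
  simp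

theorem smoothHinge_eq {ε : ℝ} (hε : 0 < ε) (t : ℝ) :
    smoothHinge ε t = (max 0 t ^ 2 - max 0 (t - ε) ^ 2) / (2 * ε) := by
  unfold smoothHinge
  split_ifs with h1 h2
  · rw [max_eq_left h1.le, max_eq_left (by linarith)]; simp
  · rw [max_eq_right (not_lt.mp h1), max_eq_left (by linarith)]; simp
  · rw [max_eq_right (not_lt.mp h1), max_eq_right (by linarith)]
    field_simp
    ring

theorem hasDerivAt_smoothHinge {ε : ℝ} (hε : 0 < ε) (t : ℝ) :
    HasDerivAt (smoothHinge ε) (max 0 (min (t / ε) 1)) t := by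
  have h := ((hasDerivAt_max_zero_sq t).sub
    ((hasDerivAt_max_zero_sq (t - ε)).comp t ((hasDerivAt_id t).sub_const ε))).div_const (2 * ε)
  rw [funext (smoothHinge_eq hε)]
  refine h.congr_deriv ?_
  rcases le_total t 0 with h1 | h1
  · have : t / ε ≤ 0 := div_nonpos_of_nonpos_of_nonneg h1 hε.le
    rw [max_eq_left h1, max_eq_left (by linarith), max_eq_left ((min_le_left _ _).trans this)]
    simp
  · have h0 : 0 ≤ t / ε := div_nonneg h1 hε.le
    rw [max_eq_right h1, max_eq_right (le_min h0 zero_le_one)]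
    rcases le_total t ε with h2 | h2
    · rw [max_eq_left (by linarith), min_eq_left ((div_le_one hε).mpr h2)]
      field_simp
      ring
    · rw [max_eq_right (by linarith), min_eq_right ((one_le_div hε).mpr h2)]
      field_simp
      ring

/-- The real-linear functional `h ↦ Re (aᴴ h)`. -/
noncomputable def reDotCLM {ι : Type*} [Fintype ι] (a : ι → ℂ) : (ι → ℂ) →L[ℝ] ℝ :=
  LinearMap.toContinuousLinearMap
    { toFun := fun h => (star a ⬝ᵥ h).re
      map_add' := fun h k => by simp [dotProduct_add]
      map_smul' := fun c h => by simp [dotProduct_smul] }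

@[simp]
theorem reDotCLM_apply {ι : Type*} [Fintype ι] (a h : ι → ℂ) :
    reDotCLM a h = (star a ⬝ᵥ h).re := rfl

theorem Matrix.IsHermitian.hasFDerivAt_re_dotProduct_mulVec {ι : Type*} [Fintype ι]
    {Q : Matrix ι ι ℂ} (hQ : Q.IsHermitian) (x : ι → ℂ) :
    HasFDerivAt (fun y : ι → ℂ => (star y ⬝ᵥ Q *ᵥ y).re) ((2 : ℝ) • reDotCLM (Q *ᵥ x)) x := by
  let B : (ι → ℂ) →ₗ[ℝ] (ι → ℂ) →ₗ[ℝ] ℝ :=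
    LinearMap.mk₂ ℝ (fun y z => (star y ⬝ᵥ Q *ᵥ z).re)
      (fun a b c => by simp [add_dotProduct])
      (fun c a b => by simp [smul_dotProduct])
      (fun a b c => by simp [mulVec_add, dotProduct_add])
      (fun c a b => by simp [mulVec_smul, dotProduct_smul])
  have h := B.toContinuousBilinearMap.hasFDerivAt_of_bilinear
    (hasFDerivAt_id (𝕜 := ℝ) x) (hasFDerivAt_id (𝕜 := ℝ) x)
  refine h.congr_fderiv ?_
  ext k
  have h1 : star (Q *ᵥ x) ⬝ᵥ k = star x ⬝ᵥ Q *ᵥ k := by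
    rw [star_mulVec, hQ.eq, dotProduct_mulVec]
  have h2 : (star k ⬝ᵥ Q *ᵥ x).re = (star (Q *ᵥ x) ⬝ᵥ k).re := by
    rw [← Complex.conj_re, ← Complex.star_def, star_dotProduct, star_star]
  change (star x ⬝ᵥ Q *ᵥ k).re + (star k ⬝ᵥ Q *ᵥ x).re = 2 * (star (Q *ᵥ x) ⬝ᵥ k).re
  rw [h2, h1]
  ring

/-- The smooth outage surrogate `u(x) = h_ε(1 − Ω(x)/ω)`, with
`Ω(x) = Re(xᴴ Q x)/(Re(xᴴ Q̄ x) + σ²)` for Hermitian positive semidefinite `Q, Q̄`,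
is Fréchet differentiable (over `ℝ`) at every `x ∈ ℂⁿ`, with derivative
`h ↦ −(2/ω)·max(0, min((1 − Ω(x)/ω)/ε, 1))·Re(gᴴ h)` where `v = Re(xᴴ Q̄ x) + σ²` and
`g = (1/v) Q x − (Re(xᴴ Q x)/v²) Q̄ x`; in particular the derivative vanishes
wherever `1 − Ω(x)/ω < 0`. -/
theorem outage_surrogate_hasFDerivAt (n : ℕ) (Q Qb : Matrix (Fin n) (Fin n) ℂ)
    (hQ : Q.PosSemidef) (hQb : Qb.PosSemidef) (σ2 ω ε : ℝ)
    (hσ : 0 < σ2) (hω : 0 < ω) (hε : 0 < ε)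
    (Ω : (Fin n → ℂ) → ℝ)
    (hΩ : ∀ y : Fin n → ℂ, Ω y = (star y ⬝ᵥ Q *ᵥ y).re / ((star y ⬝ᵥ Qb *ᵥ y).re + σ2))
    (u : (Fin n → ℂ) → ℝ) (hu : ∀ y : Fin n → ℂ, u y = smoothHinge ε (1 - Ω y / ω))
    (x : Fin n → ℂ) (v : ℝ) (hv : v = (star x ⬝ᵥ Qb *ᵥ x).re + σ2)
    (g : Fin n → ℂ)
    (hg : g = (1 / v : ℝ) • (Q *ᵥ x) - ((star x ⬝ᵥ Q *ᵥ x).re / v ^ 2 : ℝ) • (Qb *ᵥ x)) :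
    ∃ L : (Fin n → ℂ) →L[ℝ] ℝ,
      HasFDerivAt u L x ∧
      (∀ h : Fin n → ℂ,
        L h = -(2 / ω) * max 0 (min ((1 - Ω x / ω) / ε) 1) * (star g ⬝ᵥ h).re) ∧
      (1 - Ω x / ω < 0 → ∀ h : Fin n → ℂ, L h = 0) := by
  have hv0 : 0 < v := by
    have := (Complex.le_def.mp (hQb.dotProduct_mulVec_nonneg x)).1
    rw [Complex.zero_re] at this
    linarith
  have hN := hQ.isHermitian.hasFDerivAt_re_dotProduct_mulVec x
  have hD := (hQb.isHermitian.hasFDerivAt_re_dotProduct_mulVec x).add_const σ2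
  have hΩ' : HasFDerivAt Ω ((2 : ℝ) • reDotCLM g) x := by
    rw [funext hΩ]
    have hinv := (hasDerivAt_inv (hv ▸ hv0.ne')).comp_hasFDerivAt x hD
    refine (hN.mul hinv).congr_fderiv ?_
    ext k
    simp only [← hv, hg, _root_.smul_apply, _root_.add_apply,
      Function.comp_apply,
      reDotCLM_apply, star_sub, star_smul, sub_dotProduct, smul_dotProduct, Complex.sub_re,
      Complex.smul_re, smul_eq_mul, star_trivial]
    field_simp
    ring
  have hu' := (hasDerivAt_smoothHinge hε (1 - Ω x / ω)).comp_hasFDerivAt x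
    ((hΩ'.mul_const ω⁻¹).const_sub 1)
  have hL : ∀ h, (-(2 / ω) * max 0 (min ((1 - Ω x / ω) / ε) 1)) • reDotCLM g h =
      -(2 / ω) * max 0 (min ((1 - Ω x / ω) / ε) 1) * (star g ⬝ᵥ h).re := fun _ => rfl
  refine ⟨(-(2 / ω) * max 0 (min ((1 - Ω x / ω) / ε) 1)) • reDotCLM g, ?_, hL, ?_⟩
  · rw [funext hu]
    refine hu'.congr_fderiv ?_
    ext k
    simp
    ring
  · intro hneg h
    have : (1 - Ω x / ω) / ε ≤ 0 := (div_neg_of_neg_of_pos hneg hε).le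
    refine (hL h).trans ?_
    rw [max_eq_left ((min_le_left _ _).trans this)]
    simp
end

section
/- Let H ∈ ℂ^{m×n}, e ∈ ℂ^m, u ∈ ℂⁿ, and V ∈ ℂ^{n×k}. Define Q = H u uᴴ Hᴴ and Q̄ = H V Vᴴ Hᴴ. Then Re(eᴴ Q Q̄ e) ≤ ‖e‖² · λmax(Hᴴ H)² · ‖u‖² · ‖V‖_F², where ‖·‖ is the Euclidean norm and ‖·‖_F the Frobenius norm. -/
open Matrix

/-- The largest eigenvalue of a Hermitian matrix. -/
noncomputable def lmax {ι : Type*} [Fintype ι] [DecidableEq ι] {A : Matrix ι ι ℂ}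
    (hA : A.IsHermitian) : ℝ := ⨆ i, hA.eigenvalues i

theorem re_star_dotProduct_self {ι : Type*} [Fintype ι] (y : ι → ℂ) :
    RCLike.re (star y ⬝ᵥ y) = ‖WithLp.toLp 2 y‖ ^ 2 := by
  rw [← inner_self_eq_norm_sq (𝕜 := ℂ), EuclideanSpace.inner_toLp_toLp, dotProduct_comm]

open scoped ComplexOrder in
theorem lmax_conjTranspose_mul_self_nonneg {ι κ : Type*} [Fintype ι] [Fintype κ] [DecidableEq κ]
    (H : Matrix ι κ ℂ) (h : (Hᴴ * H).IsHermitian) : 0 ≤ lmax h :=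
  Real.iSup_nonneg fun i => (posSemidef_conjTranspose_mul_self H).eigenvalues_nonneg i

open scoped MatrixOrder in
/-- Rayleigh bound: `‖H x‖² ≤ λmax(Hᴴ H) ‖x‖²`. -/
theorem norm_mulVec_sq_le_lmax {ι κ : Type*} [Fintype ι] [Fintype κ] [DecidableEq κ]
    (H : Matrix ι κ ℂ) (h : (Hᴴ * H).IsHermitian) (x : κ → ℂ) :
    ‖WithLp.toLp 2 (H *ᵥ x)‖ ^ 2 ≤ lmax h * ‖WithLp.toLp 2 x‖ ^ 2 := by
  have hle : Hᴴ * H ≤ algebraMap ℝ (Matrix κ κ ℂ) (lmax h) := by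
    refine le_algebraMap_of_spectrum_le (fun r hr => ?_) h
    obtain ⟨i, rfl⟩ := h.spectrum_real_eq_range_eigenvalues ▸ hr
    exact le_ciSup (Set.finite_range _).bddAbove i
  have hpos := (Matrix.le_iff.mp hle).re_dotProduct_nonneg x
  have hH : star x ⬝ᵥ (Hᴴ * H) *ᵥ x = star (H *ᵥ x) ⬝ᵥ (H *ᵥ x) := by
    rw [← mulVec_mulVec, dotProduct_mulVec, star_mulVec]
  rw [sub_mulVec, dotProduct_sub, map_sub, hH, re_star_dotProduct_self, Algebra.algebraMap_eq_smul_one,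
    smul_mulVec, one_mulVec, dotProduct_smul, RCLike.smul_re, re_star_dotProduct_self] at hpos
  linarith

/-- Cauchy–Schwarz for the standard Hermitian form. -/
theorem norm_star_dotProduct_le {ι : Type*} [Fintype ι] (a b : ι → ℂ) :
    ‖star a ⬝ᵥ b‖ ≤ ‖WithLp.toLp 2 a‖ * ‖WithLp.toLp 2 b‖ := by
  rw [dotProduct_comm, ← EuclideanSpace.inner_toLp_toLp]
  exact norm_inner_le_norm _ _

theorem re_trace_conjTranspose_mul_self {ι κ : Type*} [Fintype ι] [Fintype κ]
    (V : Matrix ι κ ℂ) :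
    ((Vᴴ * V).trace).re = ∑ j, ‖WithLp.toLp 2 (V.col j)‖ ^ 2 := by
  rw [trace, Complex.re_sum]
  exact Finset.sum_congr rfl fun j _ => re_star_dotProduct_self (V.col j)

theorem star_dotProduct_mul_conjTranspose_mulVec {ι κ : Type*} [Fintype ι] [Fintype κ]
    (W : Matrix ι κ ℂ) (a b : ι → ℂ) :
    star a ⬝ᵥ (W * Wᴴ) *ᵥ b = ∑ j, (star a ⬝ᵥ W.col j) * (star (W.col j) ⬝ᵥ b) := by
  rw [← mulVec_mulVec, dotProduct_mulVec]
  rfl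

/-- For `H ∈ ℂ^{m×n}`, `e ∈ ℂ^m`, `u ∈ ℂⁿ`, `V ∈ ℂ^{n×k}`, with `Q = H u uᴴ Hᴴ` and
`Q̄ = H V Vᴴ Hᴴ`: `Re(eᴴ Q Q̄ e) ≤ ‖e‖² · λmax(Hᴴ H)² · ‖u‖² · ‖V‖_F²`, where `‖·‖` is the
Euclidean norm and `‖V‖_F² = Tr(Vᴴ V)` the squared Frobenius norm. -/
theorem re_quadform_QQbar_le (m n k : ℕ) (H : Matrix (Fin m) (Fin n) ℂ)
    (e : EuclideanSpace ℂ (Fin m)) (u : EuclideanSpace ℂ (Fin n))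
    (V : Matrix (Fin n) (Fin k) ℂ)
    (Q Qb : Matrix (Fin m) (Fin m) ℂ)
    (hQ : Q = H * Matrix.vecMulVec (fun i => u i) (star fun i => u i) * Hᴴ)
    (hQb : Qb = H * V * Vᴴ * Hᴴ)
    (h2 : (Hᴴ * H).IsHermitian) :
    ((star (fun i => e i) ⬝ᵥ (Q * Qb) *ᵥ (fun i => e i)).re)
      ≤ ‖e‖ ^ 2 * lmax h2 ^ 2 * ‖u‖ ^ 2 * ((Vᴴ * V).trace).re := by
  set w := H *ᵥ (fun i => u i) with hw
  have hQw : Q = vecMulVec w (star w) := by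
    rw [hQ, mul_vecMulVec, vecMulVec_mul, hw, star_mulVec]
  have hQbW : Qb = (H * V) * (H * V)ᴴ := by
    rw [hQb, conjTranspose_mul, ← Matrix.mul_assoc]
  have hform : star (fun i => e i) ⬝ᵥ (Q * Qb) *ᵥ (fun i => e i)
      = (star (fun i => e i) ⬝ᵥ w) * ∑ j, (star w ⬝ᵥ H *ᵥ V.col j) *
        (star (H *ᵥ V.col j) ⬝ᵥ fun i => e i) := by
    rw [← mulVec_mulVec, hQw, vecMulVec_mulVec, dotProduct_smul, hQbW,
      star_dotProduct_mul_conjTranspose_mulVec, op_smul_eq_smul, smul_eq_mul, mul_comm]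
    rfl
  have hu : ‖WithLp.toLp 2 w‖ ^ 2 ≤ lmax h2 * ‖u‖ ^ 2 := norm_mulVec_sq_le_lmax H h2 _
  have hlmax : 0 ≤ lmax h2 := lmax_conjTranspose_mul_self_nonneg H h2
  have hsum : ‖∑ j, (star w ⬝ᵥ H *ᵥ V.col j) * (star (H *ᵥ V.col j) ⬝ᵥ fun i => e i)‖
      ≤ ‖WithLp.toLp 2 w‖ * ‖e‖ * (lmax h2 * ((Vᴴ * V).trace).re) := by
    rw [re_trace_conjTranspose_mul_self, Finset.mul_sum, Finset.mul_sum]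
    refine norm_sum_le_of_le _ fun j _ => ?_
    rw [norm_mul]
    calc _ ≤ (‖WithLp.toLp 2 w‖ * ‖WithLp.toLp 2 (H *ᵥ V.col j)‖) *
          (‖WithLp.toLp 2 (H *ᵥ V.col j)‖ * ‖e‖) :=
          mul_le_mul (norm_star_dotProduct_le _ _) (norm_star_dotProduct_le _ _)
            (norm_nonneg _) (by positivity)
      _ = ‖WithLp.toLp 2 w‖ * ‖e‖ * ‖WithLp.toLp 2 (H *ᵥ V.col j)‖ ^ 2 := by ring
      _ ≤ _ := by gcongr; exact norm_mulVec_sq_le_lmax H h2 _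
  have htrace : 0 ≤ ((Vᴴ * V).trace).re := by
    rw [re_trace_conjTranspose_mul_self]
    positivity
  rw [hform]
  refine (Complex.re_le_norm _).trans ?_
  rw [norm_mul]
  calc _ ≤ (‖e‖ * ‖WithLp.toLp 2 w‖) *
        (‖WithLp.toLp 2 w‖ * ‖e‖ * (lmax h2 * ((Vᴴ * V).trace).re)) :=
        mul_le_mul (norm_star_dotProduct_le _ _) hsum (norm_nonneg _) (by positivity)
    _ = ‖e‖ ^ 2 * (lmax h2 * ((Vᴴ * V).trace).re) * ‖WithLp.toLp 2 w‖ ^ 2 := by ring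
    _ ≤ ‖e‖ ^ 2 * (lmax h2 * ((Vᴴ * V).trace).re) * (lmax h2 * ‖u‖ ^ 2) := by gcongr
    _ = _ := by ring
end
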